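/- Let r > 0, T ≥ 0, and let G : [0,∞) → [0,∞) be a non-decreasing function with G(s) ≥ s for all s ≥ 0. Let x : [−T,∞) → ℝ^N be a bounded function such that ‖x‖_{[t,t+r]} ≤ G(‖x‖_{[t−T,t]}) for all t ≥ 0. Then for every t ≥ 0, ‖x‖_{[t−T,t]} ≤ G^{(1+⌊t/r⌋)}(‖x‖_{[−T,0]}), where G^{(k)} denotes the k-fold composition of G with itself and ⌊t/r⌋ is the integer part of t/r. -/

import Mathlib

open scoped BigOperators

/-- Euclidean norm of a vector in ℝ^N. -/
noncomputable def eNorm {m : ℕ} (v : Fin m → ℝ) : ℝ := Real.sqrt (∑ i, (v i) ^ 2)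

/-- Sup (over [α, β]) of the Euclidean norm of a vector-valued signal. -/
noncomputable def vNorm {m : ℕ} (x : ℝ → Fin m → ℝ) (α β : ℝ) : ℝ :=
  sSup ((fun τ => eNorm (x τ)) '' Set.Icc α β)

theorem eNorm_nonneg {m : ℕ} (v : Fin m → ℝ) : 0 ≤ eNorm v := Real.sqrt_nonneg _

theorem vNorm_nonneg {m : ℕ} (x : ℝ → Fin m → ℝ) (α β : ℝ) : 0 ≤ vNorm x α β := by
  apply Real.sSup_nonneg
  rintro _ ⟨τ, -, rfl⟩
  exact eNorm_nonneg _

theorem vNorm_le {m : ℕ} {x : ℝ → Fin m → ℝ} {α β C : ℝ} (hαβ : α ≤ β)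
    (h : ∀ τ, α ≤ τ → τ ≤ β → eNorm (x τ) ≤ C) : vNorm x α β ≤ C := by
  refine csSup_le ((Set.nonempty_Icc.2 hαβ).image _) ?_
  rintro _ ⟨τ, hτ, rfl⟩
  exact h τ hτ.1 hτ.2

theorem eNorm_le_vNorm {m : ℕ} {x : ℝ → Fin m → ℝ} {α β M τ : ℝ}
    (hM : ∀ s, α ≤ s → eNorm (x s) ≤ M) (hα : α ≤ τ) (hβ : τ ≤ β) :
    eNorm (x τ) ≤ vNorm x α β := by
  refine le_csSup ⟨M, ?_⟩ ⟨τ, ⟨hα, hβ⟩, rfl⟩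
  rintro _ ⟨s, hs, rfl⟩
  exact hM s hs.1

/-- After `n` steps of length `r`, the signal is bounded by the `n`-th iterate of `G`. -/
theorem eNorm_le_iterate {r T : ℝ} (hr : 0 < r) (hT : 0 ≤ T) {N : ℕ}
    {G : ℝ → ℝ} (hGmono : MonotoneOn G (Set.Ici 0)) (hGge : ∀ s, 0 ≤ s → s ≤ G s)
    {x : ℝ → Fin N → ℝ} {M : ℝ} (hM : ∀ t, -T ≤ t → eNorm (x t) ≤ M)
    (hstep : ∀ t, 0 ≤ t → vNorm x t (t + r) ≤ G (vNorm x (t - T) t)) (n : ℕ) :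
    ∀ s, -T ≤ s → s ≤ n * r → eNorm (x s) ≤ G^[n] (vNorm x (-T) 0) := by
  induction n with
  | zero =>
    intro s hs hs'
    exact eNorm_le_vNorm hM hs (by simpa using hs')
  | succ n ih =>
    intro s hs hs'
    have hn : 0 ≤ (n : ℝ) * r := by positivity
    have h0 : 0 ≤ G^[n] (vNorm x (-T) 0) :=
      (eNorm_nonneg _).trans (ih (n * r) (by linarith) le_rfl)
    rw [Function.iterate_succ_apply']
    rcases le_total s (n * r) with h | h
    · exact (ih s hs h).trans (hGge _ h0)
    · push_cast at hs'
      calc eNorm (x s) ≤ vNorm x (n * r) (n * r + r) :=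
            eNorm_le_vNorm (fun u hu => hM u (by linarith)) h (by linarith)
        _ ≤ G (vNorm x (n * r - T) (n * r)) := hstep _ hn
        _ ≤ G (G^[n] (vNorm x (-T) 0)) :=
            hGmono (vNorm_nonneg _ _ _) h0
              (vNorm_le (by linarith) fun τ h₁ h₂ => ih τ (by linarith) h₂)

/-- The method-of-steps estimate (3.12)/(3.13): if
`‖x‖_{[t,t+r]} ≤ G(‖x‖_{[t-T,t]})` for all `t ≥ 0`, then
`‖x‖_{[t-T,t]} ≤ G^{(1+⌊t/r⌋)}(‖x‖_{[-T,0]})` for all `t ≥ 0`. -/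
theorem method_of_steps_bound (r T : ℝ) (hr : 0 < r) (hT : 0 ≤ T) (N : ℕ)
    (G : ℝ → ℝ) (hGmono : MonotoneOn G (Set.Ici 0)) (hGge : ∀ s, 0 ≤ s → s ≤ G s)
    (x : ℝ → Fin N → ℝ) (hbdd : ∃ M : ℝ, ∀ t, -T ≤ t → eNorm (x t) ≤ M)
    (hstep : ∀ t, 0 ≤ t → vNorm x t (t + r) ≤ G (vNorm x (t - T) t)) :
    ∀ t, 0 ≤ t → vNorm x (t - T) t ≤ G^[1 + Nat.floor (t / r)] (vNorm x (-T) 0) := by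
  intro t ht
  obtain ⟨M, hM⟩ := hbdd
  have hlt : t < (1 + Nat.floor (t / r) : ℕ) * r := by
    have := Nat.lt_floor_add_one (t / r)
    rw [div_lt_iff₀ hr] at this
    push_cast
    linarith
  exact vNorm_le (by linarith) fun τ h₁ h₂ =>
    eNorm_le_iterate hr hT hGmono hGge hM hstep _ τ (by linarith) (h₂.trans hlt.le)
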